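/- For all integers m, n ≥ 2, when A is a complete DFA with m states having exactly one final state which is not the initial state (k1 = 1), the upper bound ((3/4)·2^m − 1)·(2^n − 1) − (2^(m−1) − 2^(m−2))·(2^(n−1) − 1) simplifies to 5·2^(m+n−3) − 2^(m−1) − 2^n + 1, which is both necessary and sufficient for a DFA accepting L(A)*·L(B) where B has n states. -/

import Mathlib

open Computability

namespace StarCat

open Classical in
/-- The subset automaton for `L(A)∗ * L(B)`, where `f` is the only final state of `A`. -/
noncomputable def D {α σ₁ σ₂ : Type} (A : DFA α σ₁) (B : DFA α σ₂) (f : σ₁) :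
    DFA α (Finset σ₁ × Finset σ₂) where
  step x c :=
    if f ∈ x.1.image (fun q => A.step q c) then
      (insert A.start (x.1.image (fun q => A.step q c)),
        insert B.start (x.2.image (fun q => B.step q c)))
    else (x.1.image (fun q => A.step q c), x.2.image (fun q => B.step q c))
  start := ({A.start}, {B.start})
  accept := {x | ∃ q ∈ x.2, q ∈ B.accept}

/-- The states that can occur. -/
def Valid {σ₁ σ₂ : Type} (s f : σ₁) (s₂ : σ₂) (x : Finset σ₁ × Finset σ₂) : Prop :=
  x.1.Nonempty ∧ x.2.Nonempty ∧ (f ∈ x.1 → s ∈ x.1 ∧ s₂ ∈ x.2)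

theorem valid_start {α σ₁ σ₂ : Type} (A : DFA α σ₁) (B : DFA α σ₂) (f : σ₁) :
    Valid A.start f B.start (D A B f).start := by
  simp [Valid, D]

theorem valid_step {α σ₁ σ₂ : Type} (A : DFA α σ₁) (B : DFA α σ₂) (f : σ₁)
    (x : Finset σ₁ × Finset σ₂) (c : α) (hx : Valid A.start f B.start x) :
    Valid A.start f B.start ((D A B f).step x c) := by
  classical
  obtain ⟨h1, h2, h3⟩ := hx
  simp only [D]
  split_ifs with h
  · refine ⟨by simp, by simp, fun _ => by simp⟩
  · exact ⟨h1.image _, h2.image _, fun h' => absurd h' (by convert h)⟩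

theorem snoc_mem_kstar {α : Type} (L : Language α) (w : List α) (c : α) :
    w ++ [c] ∈ L∗ ↔ ∃ u v, w = u ++ v ∧ u ∈ L∗ ∧ v ++ [c] ∈ L := by
  constructor
  · intro h
    rw [Language.mem_kstar_iff_exists_nonempty] at h
    obtain ⟨S, hS, hL⟩ := h
    rcases List.eq_nil_or_concat S with rfl | ⟨S', y, rfl⟩
    · simp at hS
    · have hy := hL y (by simp)
      rcases List.eq_nil_or_concat y with rfl | ⟨v, d, rfl⟩
      · exact absurd rfl hy.2
      · simp only [List.concat_eq_append, List.flatten_append, List.flatten_cons,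
          List.flatten_nil, List.append_nil, ← List.append_assoc] at hS
        obtain ⟨h1, h2⟩ := List.append_inj' hS rfl
        obtain rfl : c = d := by simpa using h2
        refine ⟨S'.flatten, v, h1, ?_, by simpa using hy.1⟩
        exact Language.mem_kstar.2 ⟨S', rfl, fun z hz => (hL z (by simp [hz])).1⟩
  · rintro ⟨u, v, rfl, hu, hv⟩
    obtain ⟨S, rfl, hS⟩ := Language.mem_kstar.1 hu
    refine Language.mem_kstar.2 ⟨S ++ [v ++ [c]], by simp, ?_⟩
    intro y hy
    rcases List.mem_append.1 hy with h | h
    · exact hS y h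
    · rw [List.mem_singleton.1 h]; exact hv

/-- The states of `M` reached by suffixes whose complementary prefix is in `K`. -/
def T {α σ : Type} (K : Language α) (M : DFA α σ) (w : List α) (q : σ) : Prop :=
  ∃ u v, w = u ++ v ∧ u ∈ K ∧ M.eval v = q

theorem T_snoc {α σ : Type} (K : Language α) (M : DFA α σ) (w : List α) (c : α) (q : σ) :
    T K M (w ++ [c]) q ↔ (∃ p, T K M w p ∧ M.step p c = q) ∨ (w ++ [c] ∈ K ∧ q = M.start) := by
  constructor
  · rintro ⟨u, v, h, hu, hv⟩
    rcases List.eq_nil_or_concat v with rfl | ⟨v, d, rfl⟩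
    · right
      simp only [List.append_nil] at h
      subst h
      exact ⟨hu, by simpa using hv.symm⟩
    · left
      simp only [List.concat_eq_append, ← List.append_assoc] at h
      obtain ⟨h1, h2⟩ := List.append_inj' h rfl
      obtain rfl : c = d := by simpa using h2
      refine ⟨_, ⟨u, v, h1, hu, rfl⟩, ?_⟩
      rw [← hv]; simp
  · rintro (⟨p, ⟨u, v, rfl, hu, rfl⟩, rfl⟩ | ⟨h, rfl⟩)
    · exact ⟨u, v ++ [c], by simp, hu, by simp⟩
    · exact ⟨w ++ [c], [], by simp, h, by simp⟩

theorem D_step {α σ₁ σ₂ : Type} [DecidableEq σ₁] [DecidableEq σ₂]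
    (A : DFA α σ₁) (B : DFA α σ₂) (f : σ₁) (x : Finset σ₁ × Finset σ₂) (c : α) :
    (D A B f).step x c = if f ∈ x.1.image (fun q => A.step q c) then
      (insert A.start (x.1.image (fun q => A.step q c)),
        insert B.start (x.2.image (fun q => B.step q c)))
    else (x.1.image (fun q => A.step q c), x.2.image (fun q => B.step q c)) := by
  simp only [D]
  congr!

theorem D_eval {α σ₁ σ₂ : Type} (A : DFA α σ₁) (B : DFA α σ₂) (f : σ₁)
    (hf : A.accept = {f}) (w : List α) :
    (∀ q, q ∈ ((D A B f).eval w).1 ↔ T (A.accepts)∗ A w q) ∧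
    (∀ q, q ∈ ((D A B f).eval w).2 ↔ T (A.accepts)∗ B w q) := by
  classical
  induction w using List.reverseRecOn with
  | nil =>
    have key : ∀ {σ : Type} (M : DFA α σ) (q : σ), q = M.start ↔ T (A.accepts)∗ M [] q := by
      intro σ M q
      constructor
      · rintro rfl
        exact ⟨[], [], rfl, Language.nil_mem_kstar _, rfl⟩
      · rintro ⟨u, v, h, hu, rfl⟩
        obtain ⟨rfl, rfl⟩ := List.append_eq_nil_iff.1 h.symm
        rfl
    constructor
    · intro q; rw [← key]; simp [D]
    · intro q; rw [← key]; simp [D]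
  | append_singleton w c ih =>
    obtain ⟨ih1, ih2⟩ := ih
    have hk : w ++ [c] ∈ (A.accepts)∗ ↔
        f ∈ ((D A B f).eval w).1.image (fun q => A.step q c) := by
      rw [snoc_mem_kstar, Finset.mem_image]
      constructor
      · rintro ⟨u, v, rfl, hu, hv⟩
        refine ⟨A.eval v, (ih1 _).2 ⟨u, v, rfl, hu, rfl⟩, ?_⟩
        rw [DFA.mem_accepts, hf] at hv
        simpa using hv
      · rintro ⟨q, hq, hqf⟩
        obtain ⟨u, v, rfl, hu, rfl⟩ := (ih1 _).1 hq
        refine ⟨u, v, rfl, hu, ?_⟩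
        rw [DFA.mem_accepts, hf]
        simpa using hqf
    have e : (D A B f).eval (w ++ [c]) = (D A B f).step ((D A B f).eval w) c := by simp
    rw [e]
    by_cases h : w ++ [c] ∈ (A.accepts)∗
    · have h' := hk.1 h
      have e2 : (D A B f).step ((D A B f).eval w) c =
        (insert A.start (((D A B f).eval w).1.image (fun q => A.step q c)),
        insert B.start (((D A B f).eval w).2.image (fun q => B.step q c))) := by
        rw [D_step, if_pos h']
      rw [e2]
      constructor
      · intro q
        rw [T_snoc]
        simp only [Finset.mem_insert, Finset.mem_image, ih1, h, true_and]
        exact or_comm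
      · intro q
        rw [T_snoc]
        simp only [Finset.mem_insert, Finset.mem_image, ih2, h, true_and]
        exact or_comm
    · have h' := fun h2 => h (hk.2 h2)
      have e2 : (D A B f).step ((D A B f).eval w) c =
        ((((D A B f).eval w).1.image (fun q => A.step q c)),
        (((D A B f).eval w).2.image (fun q => B.step q c))) := by
        rw [D_step, if_neg h']
      rw [e2]
      constructor
      · intro q
        rw [T_snoc]
        simp only [Finset.mem_image, ih1, h, false_and, or_false]
      · intro q
        rw [T_snoc]
        simp only [Finset.mem_image, ih2, h, false_and, or_false]

theorem D_accepts {α σ₁ σ₂ : Type} (A : DFA α σ₁) (B : DFA α σ₂) (f : σ₁)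
    (hf : A.accept = {f}) : (D A B f).accepts = (A.accepts)∗ * B.accepts := by
  ext w
  rw [DFA.mem_accepts, Language.mem_mul]
  constructor
  · rintro ⟨q, hq, hqB⟩
    obtain ⟨u, v, rfl, hu, rfl⟩ := ((D_eval A B f hf w).2 q).1 hq
    exact ⟨u, hu, v, hqB, rfl⟩
  · rintro ⟨u, hu, v, hv, rfl⟩
    exact ⟨B.eval v, ((D_eval A B f hf _).2 _).2 ⟨u, v, rfl, hu, rfl⟩, hv⟩

theorem card_valid {σ₁ σ₂ : Type} [Fintype σ₁] [Fintype σ₂] (s f : σ₁) (s₂ : σ₂) (hsf : f ≠ s)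
    (k l : ℕ) (h1 : Fintype.card σ₁ = k + 2) (h2 : Fintype.card σ₂ = l + 2)
    [Fintype {x : Finset σ₁ × Finset σ₂ // Valid s f s₂ x}] :
    Fintype.card {x : Finset σ₁ × Finset σ₂ // Valid s f s₂ x} =
      (2 ^ (k + 1) - 1) * (2 ^ (l + 2) - 1) + 2 ^ k * 2 ^ (l + 1) := by
  classical
  rw [Fintype.card_of_subtype
    ((Finset.Ioc ∅ (Finset.univ.erase f) ×ˢ Finset.Ioc ∅ Finset.univ) ∪
      (Finset.Icc {f, s} Finset.univ ×ˢ Finset.Icc {s₂} Finset.univ))]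
  · rw [Finset.card_union_of_disjoint]
    · rw [Finset.card_product, Finset.card_product, Finset.card_Ioc_finset (by simp),
        Finset.card_Ioc_finset (by simp), Finset.card_Icc_finset (by simp),
        Finset.card_Icc_finset (by simp), Finset.card_pair hsf]
      simp [h1, h2]
    · rw [Finset.disjoint_left]
      rintro ⟨P, R⟩ h h'
      simp only [Finset.mem_product, Finset.mem_Ioc, Finset.mem_Icc] at h h'
      have a := h.1.2 (h'.1.1 (Finset.mem_insert_self _ _))
      simp at a
  · rintro ⟨P, R⟩
    simp only [Valid, Finset.mem_union, Finset.mem_product, Finset.mem_Ioc, Finset.mem_Icc,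
      Finset.empty_ssubset, Finset.subset_univ, and_true,
      Finset.insert_subset_iff, Finset.singleton_subset_iff, Finset.subset_erase, true_and]
    constructor
    · rintro (⟨⟨h1, h2⟩, h3⟩ | ⟨⟨h1, h2⟩, h3⟩)
      · exact ⟨h1, h3, fun h => absurd h h2⟩
      · exact ⟨⟨_, h1⟩, ⟨_, h3⟩, fun _ => ⟨h2, h3⟩⟩
    · rintro ⟨h1, h2, h3⟩
      by_cases h : f ∈ P
      · right; have := h3 h; tauto
      · left; tauto

theorem arith1 (k l : ℕ) : (2 ^ (k + 1) - 1) * (2 ^ (l + 2) - 1) + 2 ^ k * 2 ^ (l + 1) =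
    5 * 2 ^ (k + l + 1) - 2 ^ (k + 1) - 2 ^ (l + 2) + 1 := by
  obtain ⟨x, hx⟩ := Nat.exists_eq_add_of_le' (Nat.one_le_two_pow (n := k))
  obtain ⟨y, hy⟩ := Nat.exists_eq_add_of_le' (Nat.one_le_two_pow (n := l))
  simp only [pow_add, hx, hy]
  have e1 : (x + 1) * 2 ^ 1 - 1 = 2 * x + 1 := by omega
  have e2 : (y + 1) * 2 ^ 2 - 1 = 4 * y + 3 := by omega
  rw [e1, e2]
  have e3 : (2 * x + 1) * (4 * y + 3) + (x + 1) * ((y + 1) * 2 ^ 1)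
    = 10 * (x * y) + 8 * x + 6 * y + 5 := by ring
  have e4 : 5 * ((x + 1) * (y + 1) * 2 ^ 1) = 10 * (x * y) + 10 * x + 10 * y + 10 := by ring
  rw [e3, e4]
  omega

theorem arith2 (k l : ℕ) : (3 * 2 ^ k - 1) * (2 ^ (l + 2) - 1) -
    (2 ^ (k + 1) - 2 ^ k) * (2 ^ (l + 1) - 1) =
    5 * 2 ^ (k + l + 1) - 2 ^ (k + 1) - 2 ^ (l + 2) + 1 := by
  obtain ⟨x, hx⟩ := Nat.exists_eq_add_of_le' (Nat.one_le_two_pow (n := k))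
  obtain ⟨y, hy⟩ := Nat.exists_eq_add_of_le' (Nat.one_le_two_pow (n := l))
  simp only [pow_add, hx, hy]
  have e1 : 3 * (x + 1) - 1 = 3 * x + 2 := by omega
  have e2 : (y + 1) * 2 ^ 2 - 1 = 4 * y + 3 := by omega
  have e5 : (x + 1) * 2 ^ 1 - (x + 1) = x + 1 := by omega
  have e6 : (y + 1) * 2 ^ 1 - 1 = 2 * y + 1 := by omega
  rw [e1, e2, e5, e6]
  have e3 : (3 * x + 2) * (4 * y + 3) = 12 * (x * y) + 9 * x + 8 * y + 6 := by ring
  have e7 : (x + 1) * (2 * y + 1) = 2 * (x * y) + x + 2 * y + 1 := by ring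
  have e4 : 5 * ((x + 1) * (y + 1) * 2 ^ 1) = 10 * (x * y) + 10 * x + 10 * y + 10 := by ring
  rw [e3, e4, e7]
  omega

/-- The restriction of `D` to valid states. -/
noncomputable def D' {α σ₁ σ₂ : Type} (A : DFA α σ₁) (B : DFA α σ₂) (f : σ₁) :
    DFA α {x : Finset σ₁ × Finset σ₂ // Valid A.start f B.start x} where
  step x c := ⟨(D A B f).step x.1 c, valid_step A B f x.1 c x.2⟩
  start := ⟨(D A B f).start, valid_start A B f⟩
  accept := {x | x.1 ∈ (D A B f).accept}

theorem D'_eval {α σ₁ σ₂ : Type} (A : DFA α σ₁) (B : DFA α σ₂) (f : σ₁) (w : List α) :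
    ((D' A B f).eval w).1 = (D A B f).eval w := by
  induction w using List.reverseRecOn with
  | nil => rfl
  | append_singleton w c ih =>
    rw [DFA.eval_append_singleton, DFA.eval_append_singleton, ← ih]
    rfl

theorem D'_accepts {α σ₁ σ₂ : Type} (A : DFA α σ₁) (B : DFA α σ₂) (f : σ₁) :
    (D' A B f).accepts = (D A B f).accepts := by
  ext w
  rw [DFA.mem_accepts, DFA.mem_accepts, ← D'_eval]
  rfl

/-- First witness automaton. -/
def WA (k : ℕ) : DFA (Fin 4) (Fin (k + 2)) where
  step i x := if x = 0 then i + 1 else if x = 1 then (if i = 0 then 0 else i + 1) else i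
  start := 0
  accept := {Fin.last (k + 1)}

/-- Second witness automaton. -/
def WB (l : ℕ) : DFA (Fin 4) (Fin (l + 2)) where
  step i x := if x = 2 then i + 1 else if x = 3 then 1 else i
  start := 0
  accept := {Fin.last (l + 1)}

/-- The subset automaton of the witnesses. -/
noncomputable abbrev WD (k l : ℕ) : DFA (Fin 4) (Finset (Fin (k + 2)) × Finset (Fin (l + 2))) :=
  D (WA k) (WB l) (Fin.last (k + 1))

/-- Reachability in the subset automaton. -/
def Reach (k l : ℕ) (P : Finset (Fin (k + 2))) (R : Finset (Fin (l + 2))) : Prop :=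
  ∃ w, (WD k l).eval w = (P, R)

theorem WD_step (k l : ℕ) (P : Finset (Fin (k + 2))) (R : Finset (Fin (l + 2))) (c : Fin 4) :
    (WD k l).step (P, R) c = 
    if Fin.last (k + 1) ∈ P.image (fun q => (WA k).step q c) then
      (insert 0 (P.image (fun q => (WA k).step q c)),
        insert 0 (R.image (fun q => (WB l).step q c)))
    else (P.image (fun q => (WA k).step q c), R.image (fun q => (WB l).step q c)) := by
  simp only [WD, D]
  congr!

theorem Reach.step {k l : ℕ} {P : Finset (Fin (k + 2))} {R : Finset (Fin (l + 2))}
    (h : Reach k l P R) (c : Fin 4) {P' : Finset (Fin (k + 2))} {R' : Finset (Fin (l + 2))}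
    (hs : (WD k l).step (P, R) c = (P', R')) : Reach k l P' R' := by
  obtain ⟨w, hw⟩ := h
  exact ⟨w ++ [c], by rw [DFA.eval_append_singleton, hw, hs]⟩

theorem imB {l : ℕ} (R : Finset (Fin (l + 2))) (c : Fin 4) (hc : c = 0 ∨ c = 1) :
    R.image (fun q => (WB l).step q c) = R := by
  rcases hc with rfl | rfl <;> simp [WB]

/-- Letter `a`, or `b`, not producing the final state. -/
theorem Reach.ab {k l : ℕ} {P : Finset (Fin (k + 2))} {R : Finset (Fin (l + 2))}
    (h : Reach k l P R) (c : Fin 4) (hc : c = 0 ∨ c = 1) {P' : Finset (Fin (k + 2))}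
    (hP : P.image (fun q => (WA k).step q c) = P') (hl : Fin.last (k + 1) ∉ P') :
    Reach k l P' R := by
  refine h.step c ?_
  rw [WD_step, imB R c hc, hP, if_neg hl]

theorem Reach.ab' {k l : ℕ} {P : Finset (Fin (k + 2))} {R : Finset (Fin (l + 2))}
    (h : Reach k l P R) (c : Fin 4) (hc : c = 0 ∨ c = 1) {P' : Finset (Fin (k + 2))}
    (hP : P.image (fun q => (WA k).step q c) = P') (hl : Fin.last (k + 1) ∈ P') :
    Reach k l (insert 0 P') (insert 0 R) := by
  refine h.step c ?_
  rw [WD_step, imB R c hc, hP, if_pos hl]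

theorem Reach.shift1 {k l : ℕ} {P : Finset (Fin (k + 2))} {R : Finset (Fin (l + 2))}
    (h : Reach k l P R) (hl : Fin.last (k + 1) ∉ P) : Reach k l P (R.image (· + 1)) := by
  refine h.step 2 ?_
  have : P.image (fun q => (WA k).step q 2) = P := by simp [WA]
  rw [WD_step, this, if_neg hl]
  simp [WB]

theorem Reach.shift {k l : ℕ} {P : Finset (Fin (k + 2))} {R : Finset (Fin (l + 2))}
    (h : Reach k l P R) (hl : Fin.last (k + 1) ∉ P) (r : Fin (l + 2)) :
    Reach k l P (R.image (· + r)) := by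
  induction r using Fin.induction with
  | zero => simpa using h
  | succ i ih =>
    have := ih.shift1 hl
    rw [Finset.image_image] at this
    convert this using 2
    funext x
    simp [add_assoc]

theorem last_add (k : ℕ) : Fin.last (k + 1) + 1 = 0 := by simp

theorem zero_sub' (k : ℕ) : (0 : Fin (k + 2)) - 1 = Fin.last (k + 1) := by
  rw [sub_eq_iff_eq_add, last_add]

theorem last_ne (k : ℕ) : Fin.last (k + 1) ≠ 0 := by
  simp [Fin.ext_iff]

theorem val_sub (k : ℕ) (p : Fin (k + 2)) (hp : p ≠ 0) : ((p - 1 : Fin (k + 2)) : ℕ) < p := by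
  rw [← Fin.lt_def]
  exact Fin.sub_one_lt_iff.2 (Fin.pos_iff_ne_zero.2 hp)

theorem Reach.loop {k l : ℕ} {S : Finset (Fin (l + 2))} (h : Reach k l {0} S) :
    Reach k l {0} (insert 0 S) := by
  have key : ∀ i : Fin (k + 1), Reach k l {i.castSucc} S := by
    intro i
    induction i using Fin.induction with
    | zero => simpa using h
    | succ i ih =>
      refine ih.ab 0 (Or.inl rfl) (by simp [WA]) ?_
      rw [Finset.mem_singleton]
      exact (Fin.castSucc_ne_last _).symm
  have h1 := (key (Fin.last k)).ab' (P' := {Fin.last (k + 1)}) 0 (Or.inl rfl) (by simp [WA])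
    (by simp)
  refine h1.ab 1 (Or.inr rfl) ?_ (by simp)
  simp [WA]

theorem reach_zero (k l : ℕ) (S : Finset (Fin (l + 2))) (hS : S.Nonempty) : Reach k l {0} S := by
  have hl : Fin.last (k + 1) ∉ ({0} : Finset (Fin (k + 2))) := by simp
  have h0 : Reach k l {0} {0} := ⟨[], rfl⟩
  induction hS using Finset.Nonempty.cons_induction with
  | singleton a => simpa using h0.shift hl a
  | cons a s has hs ih =>
    have := ((ih.shift hl (-a)).loop).shift hl a
    rw [Finset.image_insert, Finset.image_image] at this
    rw [Finset.cons_eq_insert]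
    convert this using 2
    · simp
    · ext x; simp

theorem reach_P (k l : ℕ) (R : Finset (Fin (l + 2))) (hR : 0 ∈ R) (c : ℕ) :
    ∀ P : Finset (Fin (k + 2)), P.card = c → P.Nonempty → (Fin.last (k + 1) ∈ P → 0 ∈ P) →
      Reach k l P R := by
  induction c using Nat.strong_induction_on with
  | _ c ihc =>
  have im : ∀ P : Finset (Fin (k + 2)),
      (P.image (· - 1)).image (fun q => (WA k).step q 0) = P := by
    intro P
    rw [Finset.image_image]
    ext x; simp [WA]
  have hinj : Function.Injective (fun p : Fin (k + 2) => p - 1) := sub_left_injective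
  have hA : ∀ P : Finset (Fin (k + 2)), P.card = c → Fin.last (k + 1) ∈ P → 0 ∈ P →
      Reach k l P R := by
    intro P hc hf h0
    have hpos : 0 < P.card := Finset.card_pos.2 ⟨_, h0⟩
    have h1 : Reach k l ((P.erase 0).image (· - 1)) R := by
      refine ihc (c - 1) (by omega) _ ?_ ?_ ?_
      · rw [Finset.card_image_of_injective _ hinj, Finset.card_erase_of_mem h0, hc]
      · exact Finset.Nonempty.image ⟨_, Finset.mem_erase.2 ⟨last_ne k, hf⟩⟩ _
      · intro h
        exfalso
        obtain ⟨p, hp, hpl⟩ := Finset.mem_image.1 h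
        rw [← zero_sub'] at hpl
        exact (Finset.mem_erase.1 hp).1 (hinj hpl)
    have h2 := h1.ab' 0 (Or.inl rfl) (im _) (Finset.mem_erase.2 ⟨last_ne k, hf⟩)
    rwa [Finset.insert_erase h0, Finset.insert_eq_of_mem hR] at h2
  have main : ∀ s : ℕ, ∀ P : Finset (Fin (k + 2)), (∑ i ∈ P, (i : ℕ)) = s → P.card = c →
      P.Nonempty → (Fin.last (k + 1) ∈ P → 0 ∈ P) → Reach k l P R := by
    intro s
    induction s using Nat.strong_induction_on with
    | _ s ihs =>
    intro P hs hc hne hval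
    by_cases hf : Fin.last (k + 1) ∈ P
    · exact hA P hc hf (hval hf)
    by_cases h0 : 0 ∈ P
    · by_cases h1 : 1 ∈ P
      · have h2 : Reach k l (P.image (· - 1)) R := by
          refine hA _ ?_ ?_ ?_
          · rw [Finset.card_image_of_injective _ hinj, hc]
          · exact Finset.mem_image.2 ⟨0, h0, zero_sub' k⟩
          · exact Finset.mem_image.2 ⟨1, h1, by simp⟩
        exact h2.ab 0 (Or.inl rfl) (im _) hf
      · by_cases hP : P.erase 0 = ∅
        · have : P = {0} := by
            rw [← Finset.insert_erase h0, hP]; rfl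
          rw [this]
          exact reach_zero k l R ⟨_, hR⟩
        · have hn0 : (0 : Fin (k + 2)) ∉ (P.erase 0).image (· - 1) := by
            intro h
            obtain ⟨p, hp, hp1⟩ := Finset.mem_image.1 h
            rw [sub_eq_zero] at hp1
            exact h1 (hp1 ▸ (Finset.mem_erase.1 hp).2)
          have hpos : 0 < P.card := Finset.card_pos.2 ⟨_, h0⟩
          have h2 : Reach k l (insert 0 ((P.erase 0).image (· - 1))) R := by
            refine ihs _ ?_ _ rfl ?_ ⟨0, by simp⟩ (fun _ => by simp)
            · rw [Finset.sum_insert hn0, Finset.sum_image (fun _ _ _ _ h => hinj h), ← hs,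
                ← Finset.add_sum_erase _ _ h0]
              refine Nat.add_lt_add_left (Finset.sum_lt_sum_of_nonempty
                (Finset.nonempty_iff_ne_empty.2 hP) ?_) _
              intro i hi
              exact val_sub k i (Finset.mem_erase.1 hi).1
            · rw [Finset.card_insert_of_notMem hn0, Finset.card_image_of_injective _ hinj,
                Finset.card_erase_of_mem h0]
              omega
          refine h2.ab 1 (Or.inr rfl) ?_ hf
          rw [Finset.image_insert, Finset.image_image]
          have e : (P.erase 0).image ((fun q => (WA k).step q 1) ∘ fun x => x - 1)
              = (P.erase 0).image id := by
            refine Finset.image_congr ?_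
            intro p hp
            have hp' := (Finset.mem_erase.1 (Finset.mem_coe.1 hp)).2
            have : p - 1 ≠ 0 := by
              intro h; rw [sub_eq_zero] at h; exact h1 (h ▸ hp')
            simp [WA, this]
          rw [e, Finset.image_id]
          have : (WA k).step 0 1 = 0 := by simp [WA]
          rw [this, Finset.insert_erase h0]
    · have h2 : Reach k l (P.image (· - 1)) R := by
        refine ihs _ ?_ _ rfl ?_ (hne.image _) ?_
        · rw [Finset.sum_image (fun _ _ _ _ h => hinj h), ← hs]
          refine Finset.sum_lt_sum_of_nonempty hne ?_
          intro i hi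
          exact val_sub k i (fun h => h0 (h ▸ hi))
        · rw [Finset.card_image_of_injective _ hinj, hc]
        · intro h
          exfalso
          obtain ⟨p, hp, hpl⟩ := Finset.mem_image.1 h
          rw [← zero_sub'] at hpl
          exact h0 (hinj hpl ▸ hp)
      exact h2.ab 0 (Or.inl rfl) (im _) hf
  intro P hc
  exact main _ P rfl hc

theorem reach_all (k l : ℕ) (x : Finset (Fin (k + 2)) × Finset (Fin (l + 2)))
    (hx : Valid (WA k).start (Fin.last (k + 1)) (WB l).start x) :
    ∃ w, (WD k l).eval w = x := by
  obtain ⟨P, R⟩ := x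
  obtain ⟨h1, h2, h3⟩ := hx
  change Reach k l P R
  by_cases hf : Fin.last (k + 1) ∈ P
  · exact reach_P k l R (h3 hf).2 _ P rfl h1 (fun h => (h3 h).1)
  · obtain ⟨r, hr⟩ := h2
    have := (reach_P k l (R.image (· + (-r))) (Finset.mem_image.2 ⟨r, hr, by simp⟩) _ P rfl h1
      (fun h => absurd h hf)).shift hf r
    rw [Finset.image_image] at this
    convert this using 1
    ext x; simp

theorem add_one_ne (l : ℕ) (r : Fin (l + 2)) (h : r ≠ Fin.last (l + 1)) : r + 1 ≠ 0 := by
  intro h'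
  rw [← last_add l] at h'
  exact h (add_right_cancel h')

theorem val_add_one' (l : ℕ) (r : Fin (l + 2)) (h : r ≠ Fin.last (l + 1)) :
    ((r + 1 : Fin (l + 2)) : ℕ) = r + 1 :=
  Fin.val_add_one_of_lt (Fin.lt_last_iff_ne_last.2 h)

theorem dist_R (k l d : ℕ) : ∀ (r : Fin (l + 2)) (x y : Finset (Fin (k + 2)) × Finset (Fin (l + 2))),
    (r : ℕ) + d = l + 1 → r ∈ x.2 → r ∉ y.2 →
    ∃ z, (WD k l).evalFrom x z ∈ (WD k l).accept ∧ (WD k l).evalFrom y z ∉ (WD k l).accept := by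
  induction d with
  | zero =>
    intro r x y hr hx hy
    have : r = Fin.last (l + 1) := by rw [Fin.ext_iff]; simpa using hr
    subst this
    refine ⟨[], ⟨_, hx, rfl⟩, ?_⟩
    rintro ⟨q, hq, hq'⟩
    have : q = Fin.last (l + 1) := hq'
    exact hy (this ▸ hq)
  | succ d ih =>
    intro r x y hr hx hy
    have hrl : r ≠ Fin.last (l + 1) := by
      rintro rfl; simp at hr
    obtain ⟨z, hz⟩ := ih (r + 1) ((WD k l).step x 2) ((WD k l).step y 2)
      (by rw [val_add_one' l r hrl]; omega)
      (by
        obtain ⟨P, R⟩ := x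
        rw [WD_step]
        split_ifs <;> simp [WB, show r ∈ R from hx])
      (by
        obtain ⟨P, R⟩ := y
        have := add_one_ne l r hrl
        rw [WD_step]
        split_ifs <;> simpa [WB, this] using hy)
    exact ⟨2 :: z, by simpa using hz⟩

theorem dist_P (k l d : ℕ) : ∀ (r : Fin (k + 2)) (x y : Finset (Fin (k + 2)) × Finset (Fin (l + 2))),
    (r : ℕ) + d = k + 1 → r ∈ x.1 → r ∉ y.1 →
    ∃ z, (WD k l).evalFrom x z ∈ (WD k l).accept ∧ (WD k l).evalFrom y z ∉ (WD k l).accept := by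
  induction d with
  | zero =>
    intro r x y hr hx hy
    have : r = Fin.last (k + 1) := by rw [Fin.ext_iff]; simpa using hr
    subst this
    have im : ∀ P : Finset (Fin (k + 2)), P.image (fun q => (WA k).step q 3) = P := by
      intro P; simp [WA]
    obtain ⟨z, hz⟩ := dist_R k l (l + 1) 0 ((WD k l).step x 3) ((WD k l).step y 3)
      (by simp)
      (by
        obtain ⟨P, R⟩ := x
        rw [WD_step, im, if_pos hx]
        simp)
      (by
        obtain ⟨P, R⟩ := y
        rw [WD_step, im, if_neg hy]
        simp [WB])
    exact ⟨3 :: z, by simpa using hz⟩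
  | succ d ih =>
    intro r x y hr hx hy
    have hrl : r ≠ Fin.last (k + 1) := by
      rintro rfl; simp at hr
    obtain ⟨z, hz⟩ := ih (r + 1) ((WD k l).step x 0) ((WD k l).step y 0)
      (by rw [val_add_one' k r hrl]; omega)
      (by
        obtain ⟨P, R⟩ := x
        have : r + 1 ∈ P.image (fun q => (WA k).step q 0) := by simpa [WA] using hx
        rw [WD_step]
        split_ifs
        · exact Finset.mem_insert_of_mem this
        · exact this)
      (by
        obtain ⟨P, R⟩ := y
        have h0 := add_one_ne k r hrl
        have : r + 1 ∉ P.image (fun q => (WA k).step q 0) := by simpa [WA] using hy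
        rw [WD_step]
        split_ifs
        · simp only [Finset.mem_insert, not_or]
          exact ⟨h0, this⟩
        · exact this)
    exact ⟨0 :: z, by simpa using hz⟩

theorem dist_all (k l : ℕ) (x y : Finset (Fin (k + 2)) × Finset (Fin (l + 2)))
    (h : ∀ z, (WD k l).evalFrom x z ∈ (WD k l).accept ↔ (WD k l).evalFrom y z ∈ (WD k l).accept) :
    x = y := by
  have hP : ∀ x y : Finset (Fin (k + 2)) × Finset (Fin (l + 2)),
      (∀ z, (WD k l).evalFrom x z ∈ (WD k l).accept ↔ (WD k l).evalFrom y z ∈ (WD k l).accept) →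
      x.1 ⊆ y.1 ∧ x.2 ⊆ y.2 := by
    intro x y h
    constructor
    · intro r hr
      by_contra hr'
      obtain ⟨z, h1, h2⟩ := dist_P k l (k + 1 - r) r x y (by omega) hr hr'
      exact h2 ((h z).1 h1)
    · intro r hr
      by_contra hr'
      obtain ⟨z, h1, h2⟩ := dist_R k l (l + 1 - r) r x y (by omega) hr hr'
      exact h2 ((h z).1 h1)
  have a := hP x y h
  have b := hP y x (fun z => (h z).symm)
  exact Prod.ext (a.1.antisymm b.1) (a.2.antisymm b.2)

theorem lower (k l : ℕ) (σ : Type) [Fintype σ] (C : DFA (Fin 4) σ)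
    (hC : C.accepts = ((WA k).accepts)∗ * (WB l).accepts) :
    5 * 2 ^ (k + l + 1) - 2 ^ (k + 1) - 2 ^ (l + 2) + 1 ≤ Fintype.card σ := by
  classical
  rw [← D_accepts (WA k) (WB l) (Fin.last (k + 1)) rfl] at hC
  choose w hw using reach_all k l
  rw [← arith1, ← card_valid (WA k).start (Fin.last (k + 1)) (WB l).start (last_ne k) k l
    (by simp) (by simp)]
  refine Fintype.card_le_of_injective (fun x => C.eval (w x.1 x.2)) ?_
  rintro ⟨x, hx⟩ ⟨y, hy⟩ hxy
  simp only at hxy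
  rw [Subtype.mk.injEq]
  refine dist_all k l x y ?_
  intro z
  have key : ∀ x hx, (WD k l).evalFrom x z ∈ (WD k l).accept ↔
      C.evalFrom (C.eval (w x hx)) z ∈ C.accept := by
    intro x hx
    have h1 : w x hx ++ z ∈ C.accepts ↔ w x hx ++ z ∈ (WD k l).accepts := by rw [hC]
    rw [DFA.mem_accepts, DFA.mem_accepts, DFA.eval, DFA.eval, DFA.evalFrom_of_append,
      DFA.evalFrom_of_append] at h1
    have h2 := hw x hx
    rw [DFA.eval] at h2
    rw [h2] at h1
    exact h1.symm
  rw [key x hx, key y hy, hxy]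

end StarCat

/-- For k₁ = 1 the general upper bound simplifies to 5·2^(m+n−3) − 2^(m−1) − 2^n + 1,
    which is both sufficient (upper bound) and necessary (lower bound) for a DFA accepting
    L(A)*·L(B) when A has exactly one final state which is not its initial state. -/
theorem starcat_state_complexity (m n : ℕ) (hm : 2 ≤ m) (hn : 2 ≤ n) :
    ((3 * 2 ^ (m - 2) - 1) * (2 ^ n - 1) -
        (2 ^ (m - 1) - 2 ^ (m - 2)) * (2 ^ (n - 1) - 1) =
      5 * 2 ^ (m + n - 3) - 2 ^ (m - 1) - 2 ^ n + 1) ∧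
    (∀ (α σ₁ σ₂ : Type) (i₁ : Fintype σ₁) (i₂ : Fintype σ₂)
        (A : DFA α σ₁) (B : DFA α σ₂),
      @Fintype.card σ₁ i₁ = m → @Fintype.card σ₂ i₂ = n →
      (∃ f, f ≠ A.start ∧ A.accept = {f}) →
      ∃ (σ : Type) (inst : Fintype σ) (C : DFA α σ),
        C.accepts = (A.accepts)∗ * B.accepts ∧
        @Fintype.card σ inst ≤ 5 * 2 ^ (m + n - 3) - 2 ^ (m - 1) - 2 ^ n + 1) ∧
    (∃ (A : DFA (Fin 4) (Fin m)) (B : DFA (Fin 4) (Fin n)),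
      (∃ f, f ≠ A.start ∧ A.accept = {f}) ∧
      ∀ (σ : Type) (inst : Fintype σ) (C : DFA (Fin 4) σ),
        C.accepts = (A.accepts)∗ * B.accepts →
        5 * 2 ^ (m + n - 3) - 2 ^ (m - 1) - 2 ^ n + 1 ≤ @Fintype.card σ inst) := by

  obtain ⟨k, rfl⟩ := Nat.exists_eq_add_of_le' hm
  obtain ⟨l, rfl⟩ := Nat.exists_eq_add_of_le' hn
  have e1 : k + 2 - 2 = k := rfl
  have e2 : k + 2 - 1 = k + 1 := rfl
  have e3 : l + 2 - 1 = l + 1 := rfl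
  have e4 : k + 2 + (l + 2) - 3 = k + l + 1 := by omega
  rw [e1, e2, e3, e4]
  refine ⟨StarCat.arith2 k l, ?_, ?_⟩
  · intro α σ₁ σ₂ i₁ i₂ A B h1 h2 ⟨f, hf, hA⟩
    classical
    refine ⟨{x : Finset σ₁ × Finset σ₂ // StarCat.Valid A.start f B.start x}, inferInstance,
      StarCat.D' A B f, ?_, ?_⟩
    · rw [StarCat.D'_accepts, StarCat.D_accepts A B f hA]
    · rw [StarCat.card_valid A.start f B.start hf k l h1 h2, StarCat.arith1]
  · refine ⟨StarCat.WA k, StarCat.WB l, ⟨Fin.last (k + 1), StarCat.last_ne k, rfl⟩, ?_⟩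
    intro σ inst C hC
    exact StarCat.lower k l σ C hC
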